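/- Let B > 0 be a constant, let μ₊ = 1/(1 + e^{−2B}), and let W ~ Binomial(k, μ₊) for an integer k ≥ 1. Define h⁺ : [0,1] → [−B, B] by h⁺(x) = (2B/μ₊)·(x − μ₊) + B for 0 ≤ x < μ₊, and h⁺(x) = B for μ₊ ≤ x ≤ 1. Then there exists a constant c > 0, depending only on B, such that E[h⁺(W/k)] − B ≤ −c/√k. -/

import Mathlib

open Finset

/-- Probability that `Binomial(k, p) = w`. -/
noncomputable def binomProb (k : ℕ) (p : ℝ) (w : ℕ) : ℝ :=
  (k.choose w : ℝ) * p ^ w * (1 - p) ^ (k - w)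

/-- `E[f(W/k)]` for `W ~ Binomial(k, p)`. -/
noncomputable def binomExp (k : ℕ) (p : ℝ) (f : ℝ → ℝ) : ℝ :=
  ∑ w ∈ Finset.range (k + 1), binomProb k p w * f ((w : ℝ) / (k : ℝ))

/-- `μ₊ = 1/(1+e^{-2B})`, the win probability of the stronger item in the
two-item BTL model with parameters `[B, -B]`. -/
noncomputable def muPlus (B : ℝ) : ℝ := 1 / (1 + Real.exp (-(2 * B)))

/-- First coordinate of the two-item MLE constrained to the box `[-B, B]`, as a
function of the observed win fraction:
`h(x) = -B` for `x ≤ 1/(1+e^{2B})`, `h(x) = -(1/2)log(1/x - 1)` for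
`1/(1+e^{2B}) < x < μ₊`, and `h(x) = B` for `x ≥ μ₊`. -/
noncomputable def hFun (B : ℝ) (x : ℝ) : ℝ :=
  if x ≤ 1 / (1 + Real.exp (2 * B)) then -B
  else if x < muPlus B then -(1 / 2) * Real.log (1 / x - 1)
  else B

/-- The piecewise-linear surrogate `h⁺`:
`h⁺(x) = (2B/p)(x - p) + B` for `x < p` and `h⁺(x) = B` for `x ≥ p`. -/
noncomputable def hPlusFun (B p : ℝ) (x : ℝ) : ℝ :=
  if x < p then 2 * B / p * (x - p) + B else B

/-- Conditioning on the last trial: `E[f(W)]` for `k + 1` trials in terms of `k` trials. -/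
theorem sum_binomProb_succ (k : ℕ) (p : ℝ) (f : ℕ → ℝ) :
    ∑ w ∈ range (k + 2), binomProb (k + 1) p w * f w =
      ∑ w ∈ range (k + 1), binomProb k p w * (p * f (w + 1) + (1 - p) * f w) := by
  have h : ∑ w ∈ range (k + 1), (k.choose (w + 1) : ℝ) * p ^ (w + 1) * (1 - p) ^ (k - w) * f (w + 1)
      + (1 - p) ^ (k + 1) * f 0 =
      ∑ w ∈ range (k + 1), binomProb k p w * ((1 - p) * f w) := by
    have h₁ := sum_range_succ'
      (fun w => (k.choose w : ℝ) * p ^ w * (1 - p) ^ (k + 1 - w) * f w) (k + 1)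
    rw [sum_range_succ] at h₁
    simp only [Nat.choose_succ_self, Nat.cast_zero, zero_mul, add_zero, Nat.add_sub_add_right,
      Nat.choose_zero_right, Nat.cast_one, pow_zero, one_mul, Nat.sub_zero] at h₁
    rw [← h₁]
    refine sum_congr rfl fun w hw => ?_
    have hw' : w ≤ k := Nat.lt_succ_iff.mp (mem_range.mp hw)
    rw [binomProb, Nat.sub_add_comm hw', pow_succ]
    ring
  simp only [mul_add, sum_add_distrib]
  rw [← h, sum_range_succ', ← add_assoc, ← sum_add_distrib]
  congr 1
  · refine sum_congr rfl fun w _ => ?_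
    simp only [binomProb, Nat.choose_succ_succ, Nat.add_sub_add_right, Nat.cast_add]
    ring
  · simp [binomProb]

/-- The binomial weights sum to one. -/
theorem sum_binomProb (k : ℕ) (p : ℝ) : ∑ w ∈ range (k + 1), binomProb k p w = 1 := by
  induction k with
  | zero => simp [binomProb]
  | succ k ih =>
    have h := sum_binomProb_succ k p fun _ => 1
    simp only [mul_one, add_sub_cancel, ih] at h
    exact h

/-- The first four central moments of the binomial distribution. -/
theorem binomial_central_moments (k : ℕ) (p : ℝ) :
    ∑ w ∈ range (k + 1), binomProb k p w * ((w : ℝ) - k * p) = 0 ∧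
    ∑ w ∈ range (k + 1), binomProb k p w * ((w : ℝ) - k * p) ^ 2 = k * (p * (1 - p)) ∧
    ∑ w ∈ range (k + 1), binomProb k p w * ((w : ℝ) - k * p) ^ 3 =
      k * (p * (1 - p)) * (1 - 2 * p) ∧
    ∑ w ∈ range (k + 1), binomProb k p w * ((w : ℝ) - k * p) ^ 4 =
      3 * k ^ 2 * (p * (1 - p)) ^ 2 + k * (p * (1 - p)) * (1 - 6 * (p * (1 - p))) := by
  induction k with
  | zero => simp [binomProb]
  | succ k ih =>
    obtain ⟨h1, h2, h3, h4⟩ := ih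
    have h0 := sum_binomProb k p
    have key : ∀ (n : ℕ) (a b c d e : ℝ),
        (∀ x : ℝ, p * (x + (1 - p)) ^ n + (1 - p) * (x - p) ^ n =
          a + b * x + c * x ^ 2 + d * x ^ 3 + e * x ^ 4) →
        ∑ w ∈ range (k + 1 + 1), binomProb (k + 1) p w * ((w : ℝ) - (k + 1 : ℕ) * p) ^ n =
          a + c * (k * (p * (1 - p))) + d * (k * (p * (1 - p)) * (1 - 2 * p)) +
          e * (3 * k ^ 2 * (p * (1 - p)) ^ 2 + k * (p * (1 - p)) * (1 - 6 * (p * (1 - p)))) := by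
      intro n a b c d e h
      rw [sum_binomProb_succ k p fun w => ((w : ℝ) - (k + 1 : ℕ) * p) ^ n, ← h4, ← h3, ← h2]
      have hb : a = a * ∑ w ∈ range (k + 1), binomProb k p w +
          b * ∑ w ∈ range (k + 1), binomProb k p w * ((w : ℝ) - k * p) := by
        rw [h0, h1]; ring
      rw [hb]
      simp only [mul_sum, ← sum_add_distrib]
      refine sum_congr rfl fun w _ => ?_
      have hx := h ((w : ℝ) - k * p)
      have e1 : ((w + 1 : ℕ) : ℝ) - (k + 1 : ℕ) * p = (w : ℝ) - k * p + (1 - p) := by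
        push_cast; ring
      have e2 : (w : ℝ) - (k + 1 : ℕ) * p = (w : ℝ) - k * p - p := by
        push_cast; ring
      rw [e1, e2, hx]
      ring
    refine ⟨?_, ?_, ?_, ?_⟩
    · have := key 1 0 1 0 0 0 fun x => by ring
      simpa using this
    · rw [key 2 (p * (1 - p)) 0 1 0 0 fun x => by ring]
      push_cast; ring
    · rw [key 3 (p * (1 - p) * (1 - 2 * p)) (3 * (p * (1 - p))) 0 1 0 fun x => by ring]
      push_cast; ring
    · rw [key 4 (p * (1 - p) * (1 - 3 * (p * (1 - p)))) (4 * (p * (1 - p) * (1 - 2 * p)))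
        (6 * (p * (1 - p))) 0 1 fun x => by ring]
      push_cast; ring

theorem sq_sub_pow_four_div_four_le_abs (u : ℝ) : u ^ 2 - u ^ 4 / 4 ≤ |u| := by
  have h2 : u ^ 2 = |u| ^ 2 := (sq_abs u).symm
  have h4 : u ^ 4 = |u| ^ 4 := by rw [show u ^ 4 = (u ^ 2) ^ 2 by ring, h2]; ring
  rw [h2, h4]
  have hv := abs_nonneg u
  generalize |u| = v at hv
  have : 0 ≤ v ^ 3 / 4 - v + 1 := by
    nlinarith [mul_nonneg hv (sq_nonneg (v - 6 / 5)), sq_nonneg (v - 6 / 5)]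
  nlinarith [mul_nonneg hv this]

/-- A polynomial upper bound for the surrogate in the deviation `w - k p`. -/
theorem hPlusFun_le {B p : ℝ} (hB : 0 < B) (hp : 0 < p) {k : ℕ} (hk : 1 ≤ k) (w : ℕ) :
    hPlusFun B p ((w : ℝ) / k) ≤ B - B / p *
      ((((w : ℝ) - k * p) ^ 2 / k - ((w : ℝ) - k * p) ^ 4 / (4 * k ^ 2)) / √k
        - ((w : ℝ) - k * p) / k) := by
  have hk0 : (0 : ℝ) < k := by exact_mod_cast hk
  have hs : 0 < √(k : ℝ) := Real.sqrt_pos.mpr hk0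
  have hsq : √(k : ℝ) ^ 2 = k := Real.sq_sqrt hk0.le
  have hx : (w : ℝ) / k - p = ((w : ℝ) - k * p) / k := by field_simp
  have hval : hPlusFun B p ((w : ℝ) / k) =
      B - B / p * (|((w : ℝ) - k * p) / k| - ((w : ℝ) - k * p) / k) := by
    rw [← hx, hPlusFun]
    split_ifs with h
    · rw [abs_of_neg (sub_neg.mpr h)]; ring
    · rw [abs_of_nonneg (sub_nonneg.mpr (not_lt.mp h))]; ring
  rw [hval]
  generalize (w : ℝ) - k * p = d
  have hu := div_le_div_of_nonneg_right (sq_sub_pow_four_div_four_le_abs (d / √k)) hs.le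
  have e1 : (d / √(k : ℝ)) ^ 2 = d ^ 2 / k := by rw [div_pow, hsq]
  have e2 : (d / √(k : ℝ)) ^ 4 / 4 = d ^ 4 / (4 * k ^ 2) := by
    rw [div_pow, show √(k : ℝ) ^ 4 = (√(k : ℝ) ^ 2) ^ 2 by ring, hsq, div_div, mul_comm]
  have e3 : |d / √(k : ℝ)| / √k = |d / k| := by
    rw [abs_div, abs_div, abs_of_pos hs, abs_of_pos hk0, div_div, ← sq, hsq]
  rw [e1, e2, e3] at hu
  gcongr

/-- Lemma 9: for `W ~ Binomial(k, μ₊)` with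
`μ₊ = 1/(1+e^{-2B})`, the surrogate satisfies `E[h⁺(W/k)] − B ≤ −c/√k` for a
constant `c > 0` depending only on `B`. -/
theorem surrogate_negative_bias (B : ℝ) (hB : 0 < B) :
    ∃ c > (0 : ℝ), ∀ k : ℕ, 1 ≤ k →
      binomExp k (muPlus B) (hPlusFun B (muPlus B)) - B ≤ -(c / Real.sqrt k) := by
  set p := muPlus B with hpdef
  have he := Real.exp_pos (-(2 * B))
  have hp : 0 < p := by rw [hpdef, muPlus]; positivity
  have hp1 : p < 1 := by
    rw [hpdef, muPlus, div_lt_one (by positivity)]; linarith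
  have hq : 0 < 1 - p := sub_pos.mpr hp1
  refine ⟨B * (1 - p) / 2, by positivity, fun k hk => ?_⟩
  have hk0 : (0 : ℝ) < k := by exact_mod_cast hk
  have hk1 : (1 : ℝ) ≤ k := by exact_mod_cast hk
  have hs : 0 < √(k : ℝ) := Real.sqrt_pos.mpr hk0
  obtain ⟨h1, h2, -, h4⟩ := binomial_central_moments k p
  have hle : binomExp k p (hPlusFun B p) ≤ ∑ w ∈ range (k + 1), binomProb k p w *
      (B - B / p * ((((w : ℝ) - k * p) ^ 2 / k - ((w : ℝ) - k * p) ^ 4 / (4 * k ^ 2)) / √k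
        - ((w : ℝ) - k * p) / k)) := by
    refine sum_le_sum fun w _ => mul_le_mul_of_nonneg_left (hPlusFun_le hB hp hk w) ?_
    unfold binomProb
    positivity
  have heq : ∑ w ∈ range (k + 1), binomProb k p w *
      (B - B / p * ((((w : ℝ) - k * p) ^ 2 / k - ((w : ℝ) - k * p) ^ 4 / (4 * k ^ 2)) / √k
        - ((w : ℝ) - k * p) / k)) =
      B * 1 - B / p / k / √k * (k * (p * (1 - p)))
        + B / p / (4 * k ^ 2) / √k *
          (3 * k ^ 2 * (p * (1 - p)) ^ 2 + k * (p * (1 - p)) * (1 - 6 * (p * (1 - p))))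
        + B / p / k * 0 := by
    rw [← h4, ← h2, ← h1, ← sum_binomProb k p]
    simp only [mul_sum, ← sum_add_distrib, ← sum_sub_distrib]
    exact sum_congr rfl fun w _ => by ring
  rw [heq] at hle
  set v := p * (1 - p) with hv
  have hv0 : 0 < v := mul_pos hp hq
  have hv4 : v ≤ 1 / 4 := by nlinarith [sq_nonneg (p - 1 / 2)]
  have hm : 3 * k ^ 2 * v ^ 2 + k * v * (1 - 6 * v) ≤ 2 * k ^ 2 * v := by
    have a1 : k ^ 2 * v * v ≤ k ^ 2 * v * (1 / 4) := by gcongr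
    have a2 : k * v * (1 - 6 * v) ≤ k * v * 1 := by gcongr; linarith
    have a3 : (k : ℝ) * v ≤ k * k * v := by gcongr; nlinarith
    have a4 : 0 < (k : ℝ) ^ 2 * v := by positivity
    nlinarith
  have hfour : B / p / (4 * k ^ 2) / √k * (3 * k ^ 2 * v ^ 2 + k * v * (1 - 6 * v)) ≤
      B / p / (4 * k ^ 2) / √k * (2 * k ^ 2 * v) := by gcongr
  have f1 : B / p / k / √k * (k * v) = 2 * (B * (1 - p) / 2 / √k) := by
    rw [hv]; field_simp
  have f2 : B / p / (4 * k ^ 2) / √k * (2 * k ^ 2 * v) = B * (1 - p) / 2 / √k := by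
    rw [hv]; field_simp; norm_num
  linarith
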